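/- Let n be a positive integer such that p = 4n−1 is prime, let M = ⌊n²/p⌋, and for integers m ≥ 0 set Q_m = 1/2 + (1/2)·√(4mp + 3p − 4) and R_m = √(mp). If M ≥ 1, then either ⌊Q_{M−1}⌋ = ⌊R_M⌋ = n−1 or ⌊Q_{M−1}⌋ = ⌊R_M⌋ = n−2. -/

import Mathlib

theorem not_prime_twentySeven : ¬ Prime (27 : ℤ) := by
  rw [Int.prime_iff_natAbs_prime]
  norm_num

/-- If `4 * n - 1` is prime and at least `15`, it divides none of the listed integers. -/
theorem prime_four_mul_sub_one_not_dvd {n c : ℤ} (hn : 4 ≤ n) (hp : Prime (4 * n - 1))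
    (hc : c = 1 ∨ c = 9 ∨ c = 17 ∨ c = 25 ∨ c = 33 ∨ c = 49 ∨ c = 65 ∨ c = 81) :
    ¬ (4 * n - 1 ∣ c) := by
  intro h
  have hle := Int.le_of_dvd (by omega) h
  have hn7 : n ≠ 7 := by
    rintro rfl
    exact not_prime_twentySeven (by simpa using hp)
  have hn' : n ≤ 20 := by omega
  interval_cases n <;> omega

theorem floor_half_add_sqrt_eq {x : ℝ} {k : ℤ} (hk : 1 ≤ k)
    (h₁ : (2 * (k : ℝ) - 1) ^ 2 ≤ x) (h₂ : x < (2 * (k : ℝ) + 1) ^ 2) :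
    ⌊1 / 2 + √x / 2⌋ = k := by
  have hk' : (1 : ℝ) ≤ k := by exact_mod_cast hk
  have h₃ := Real.le_sqrt_of_sq_le h₁
  have h₄ := (Real.sqrt_lt' (by linarith)).2 h₂
  rw [Int.floor_eq_iff]
  constructor <;> linarith

theorem floor_sqrt_eq {x : ℝ} {k : ℤ} (hk : 0 ≤ k)
    (h₁ : (k : ℝ) ^ 2 ≤ x) (h₂ : x < ((k : ℝ) + 1) ^ 2) : ⌊√x⌋ = k := by
  have hk' : (0 : ℝ) ≤ k := by exact_mod_cast hk
  rw [Int.floor_eq_iff]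
  exact ⟨Real.le_sqrt_of_sq_le h₁, (Real.sqrt_lt' (by linarith)).2 h₂⟩


/-- Lemma 8(i): if `M ≥ 1` then either `⌊Q_{M-1}⌋ = ⌊R_M⌋ = n-1` or
`⌊Q_{M-1}⌋ = ⌊R_M⌋ = n-2`. -/
theorem stmt_14 (n : ℤ) (hn : 0 < n) (p : ℤ) (hp : p = 4 * n - 1) (hpp : Prime p)
    (M : ℤ) (hM : M = n ^ 2 / p)
    (Q R : ℤ → ℝ)
    (hQ : ∀ m, Q m = 1 / 2 + Real.sqrt (4 * (m : ℝ) * (p : ℝ) + 3 * (p : ℝ) - 4) / 2)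
    (hR : ∀ m, R m = Real.sqrt ((m : ℝ) * (p : ℝ)))
    (hM1 : 1 ≤ M) :
    (⌊Q (M - 1)⌋ = n - 1 ∧ ⌊R M⌋ = n - 1) ∨
    (⌊Q (M - 1)⌋ = n - 2 ∧ ⌊R M⌋ = n - 2) := by
  subst hp
  obtain ⟨r, hr⟩ : ∃ r, r = n ^ 2 % (4 * n - 1) := ⟨_, rfl⟩
  have hr0 : 0 ≤ r := hr ▸ Int.emod_nonneg _ (by omega)
  have hrp : r < 4 * n - 1 := hr ▸ Int.emod_lt_of_pos _ (by omega)
  have hdiv : (4 * n - 1) * M + r = n ^ 2 := by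
    rw [hM, hr]
    exact Int.mul_ediv_add_emod _ _
  have hn4 : 4 ≤ n := by
    by_contra! hlt
    interval_cases n <;> omega
  have hd : 4 * n - 1 ∣ 16 * r - 1 := ⟨4 * n + 1 - 16 * M, by linear_combination 16 * hdiv⟩
  have key (a c : ℤ) (hc : c = 1 ∨ c = 9 ∨ c = 17 ∨ c = 25 ∨ c = 33 ∨ c = 49 ∨ c = 65 ∨ c = 81) :
      16 * r - 1 ≠ (4 * n - 1) * a - c := by
    intro h
    rw [h] at hd
    exact prime_four_mul_sub_one_not_dvd hn4 hpp hc
      ((Int.dvd_iff_dvd_of_dvd_sub (by simpa using hd)).1 (dvd_mul_right _ a))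
  have k₀ := key 0 1 (by simp)
  have k₁ := key 8 25 (by simp)
  have k₂ := key 8 9 (by simp)
  have k₃ := key 16 17 (by simp)
  have k₄ := key 16 33 (by simp)
  have k₅ := key 16 49 (by simp)
  have k₆ := key 16 65 (by simp)
  have k₇ := key 16 81 (by simp)
  have hdivR : (4 * (n : ℝ) - 1) * M + r = (n : ℝ) ^ 2 := by exact_mod_cast hdiv
  have hr1 : (1 : ℝ) ≤ r := by exact_mod_cast (by omega : 1 ≤ r)
  rw [hQ, hR]
  push_cast
  rcases le_or_gt r (2 * n - 3) with hle | hgt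
  · have hleR : (r : ℝ) ≤ 2 * n - 3 := by exact_mod_cast hle
    left
    constructor
    · apply floor_half_add_sqrt_eq (by omega) <;> push_cast <;> nlinarith
    · apply floor_sqrt_eq (by omega) <;> push_cast <;> nlinarith
  · have hgeR : 2 * (n : ℝ) ≤ r := by exact_mod_cast (by omega : 2 * n ≤ r)
    have hleR : (r : ℝ) ≤ 4 * n - 7 := by exact_mod_cast (by omega : r ≤ 4 * n - 7)
    right
    constructor
    · apply floor_half_add_sqrt_eq (by omega) <;> push_cast <;> nlinarith
    · apply floor_sqrt_eq (by omega) <;> push_cast <;> nlinarith
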